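/- arXiv:1410.2592 — 3 statements merged into one kernel-verified Lean document; each statement's English description precedes it below -/
import Mathlib

section
/- Fix K ≥ 1 and η > 0, and set γ(t) = min{η, η t^{−1/2}} for t > 0 with γ(0) = η. Let v : [0, ∞) → ℝ^K be measurable and bounded on compact intervals, set y(t) = ∫₀^t v(s) ds and q(t) = G(γ(t) y(t)) ∈ Δ, and suppose that for (almost) every t ≥ 0 there is a function Φ_t : Δ → ℝ such that v(t) is a supergradient of Φ_t at q(t) and such that t ↦ Φ_t(q₀) and t ↦ Φ_t(q(t)) are locally integrable for each q₀ ∈ Δ. Then for every q₀ ∈ Δ and every T ≥ 1, the continuous-time regret satisfies ∫₀^T [Φ_t(q₀) − Φ_t(q(t))] dt ≤ η^{−1} (log K) √T. -/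
open MeasureTheory

/-- The Gibbs (softmax) map `G : ℝ^K → Δ`. -/
noncomputable def gibbs (K : ℕ) (y : Fin K → ℝ) : Fin K → ℝ :=
  fun k => Real.exp (y k) / ∑ ℓ, Real.exp (y ℓ)

/-- The learning-rate schedule `γ(t) = min{η, η t^{−1/2}}` for `t > 0`, with `γ(0) = η`. -/
noncomputable def gammaRate (η : ℝ) (t : ℝ) : ℝ :=
  if t ≤ 0 then η else min η (η / Real.sqrt t)

open Filter Topology

section Gibbs

variable {K : ℕ}

/-- The normalised log-partition function `γ⁻¹ log (K⁻¹ ∑ₖ exp (γ yₖ))`. -/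
noncomputable def freeEnergy (γ : ℝ) (y : Fin K → ℝ) : ℝ :=
  γ⁻¹ * (Real.log (∑ k, Real.exp (γ * y k)) - Real.log K)

lemma freeEnergy_zero (γ : ℝ) : freeEnergy γ (0 : Fin K → ℝ) = 0 := by
  simp [freeEnergy]

variable [NeZero K]

lemma sum_exp_pos (y : Fin K → ℝ) : 0 < ∑ k, Real.exp (y k) :=
  Finset.sum_pos (fun _ _ => Real.exp_pos _) Finset.univ_nonempty

lemma gibbs_mem_stdSimplex (y : Fin K → ℝ) : gibbs K y ∈ stdSimplex ℝ (Fin K) := by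
  refine ⟨fun k => div_nonneg (Real.exp_pos _).le (sum_exp_pos y).le, ?_⟩
  simp only [gibbs]
  rw [← Finset.sum_div, div_self (sum_exp_pos y).ne']

lemma continuous_gibbs : Continuous (gibbs K) := by
  unfold gibbs
  refine continuous_pi fun k => Continuous.div (by fun_prop) (by fun_prop) fun y => ?_
  exact (sum_exp_pos y).ne'

/-- The log-sum-exp function lies above its tangent hyperplanes. -/
lemma log_sum_exp_sub_le (a b : Fin K → ℝ) :
    Real.log (∑ k, Real.exp (b k)) - Real.log (∑ k, Real.exp (a k)) ≤
      ∑ k, gibbs K b k * (b k - a k) := by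
  obtain ⟨h0, h1⟩ := gibbs_mem_stdSimplex b
  have hJ := convexOn_exp.map_sum_le (t := Finset.univ) (w := gibbs K b)
    (p := fun k => a k - b k) (fun k _ => h0 k) h1 (fun _ _ => Set.mem_univ _)
  have hS : ∑ k, gibbs K b k • Real.exp (a k - b k) =
      (∑ k, Real.exp (a k)) / ∑ k, Real.exp (b k) := by
    rw [Finset.sum_div]
    refine Finset.sum_congr rfl fun k _ => ?_
    rw [gibbs, smul_eq_mul, Real.exp_sub]
    field_simp
  rw [hS, ← Real.le_log_iff_exp_le (div_pos (sum_exp_pos a) (sum_exp_pos b)),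
    Real.log_div (sum_exp_pos a).ne' (sum_exp_pos b).ne'] at hJ
  have hneg : ∑ k, gibbs K b k * (b k - a k) = -∑ k, gibbs K b k • (a k - b k) := by
    rw [← Finset.sum_neg_distrib]
    exact Finset.sum_congr rfl fun k _ => by rw [smul_eq_mul]; ring
  linarith

lemma freeEnergy_sub_le {γ : ℝ} (hγ : 0 < γ) (x y : Fin K → ℝ) :
    freeEnergy γ y - freeEnergy γ x ≤ ∑ k, gibbs K (γ • y) k * (y k - x k) := by
  have h := mul_le_mul_of_nonneg_left (log_sum_exp_sub_le (γ • x) (γ • y)) (inv_pos.2 hγ).le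
  have hs : γ⁻¹ * ∑ k, gibbs K (γ • y) k * ((γ • y) k - (γ • x) k) =
      ∑ k, gibbs K (γ • y) k * (y k - x k) := by
    rw [Finset.mul_sum]
    refine Finset.sum_congr rfl fun k _ => ?_
    simp only [Pi.smul_apply, smul_eq_mul]
    field_simp
  rw [hs] at h
  simp only [Pi.smul_apply, smul_eq_mul] at h
  unfold freeEnergy
  linarith

lemma freeEnergy_mono {γ γ' : ℝ} (hγ : 0 < γ) (h : γ ≤ γ') (y : Fin K → ℝ) :
    freeEnergy γ y ≤ freeEnergy γ' y := by
  have hγ' : 0 < γ' := hγ.trans_le h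
  have hK : (0 : ℝ) < K := Nat.cast_pos.2 (NeZero.pos K)
  have hp := Real.rpow_arith_mean_le_arith_mean_rpow Finset.univ (fun _ : Fin K => (K : ℝ)⁻¹)
    (fun k => Real.exp (γ * y k)) (fun _ _ => by positivity) (by simp [hK.ne'])
    (fun _ _ => (Real.exp_pos _).le) ((one_le_div hγ).2 h)
  have he : ∀ k, Real.exp (γ * y k) ^ (γ' / γ) = Real.exp (γ' * y k) := fun k => by
    rw [← Real.exp_mul]
    congr 1
    field_simp
  simp only [he, ← Finset.mul_sum] at hp
  have h1 := sum_exp_pos fun k => γ * y k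
  have h2 := sum_exp_pos fun k => γ' * y k
  have hl := Real.log_le_log (by positivity) hp
  rw [Real.log_rpow (by positivity), Real.log_mul (by positivity) h1.ne',
    Real.log_mul (by positivity) h2.ne', Real.log_inv] at hl
  have hm := mul_le_mul_of_nonneg_left hl (inv_pos.2 hγ').le
  have hc : γ'⁻¹ * (γ' / γ * (-Real.log K + Real.log (∑ k, Real.exp (γ * y k)))) =
      freeEnergy γ y := by
    unfold freeEnergy
    field_simp
    ring
  rw [hc] at hm
  unfold freeEnergy at hm ⊢
  linarith

lemma sum_mul_sub_le_freeEnergy {γ : ℝ} (hγ : 0 < γ) (y : Fin K → ℝ) {p : Fin K → ℝ}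
    (hp : p ∈ stdSimplex ℝ (Fin K)) :
    ∑ k, p k * y k - γ⁻¹ * Real.log K ≤ freeEnergy γ y := by
  have h1 : ∀ k, y k ≤ γ⁻¹ * Real.log (∑ j, Real.exp (γ * y j)) := fun k => by
    rw [inv_mul_eq_div, le_div_iff₀ hγ, Real.le_log_iff_exp_le (sum_exp_pos _), mul_comm]
    exact Finset.single_le_sum (f := fun j => Real.exp (γ * y j))
      (fun j _ => (Real.exp_pos _).le) (Finset.mem_univ k)
  have h2 := Finset.sum_le_sum fun k (_ : k ∈ Finset.univ) =>
    mul_le_mul_of_nonneg_left (h1 k) (hp.1 k)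
  rw [← Finset.sum_mul, hp.2, one_mul] at h2
  unfold freeEnergy
  linarith

end Gibbs

section BoundedStream

variable {K : ℕ} {v : ℝ → Fin K → ℝ} {B : ℝ}

lemma intervalIntegrable_coord (hv : Measurable v) (hB : ∀ t k, |v t k| ≤ B) (k : Fin K)
    (a b : ℝ) : IntervalIntegrable (fun t => v t k) volume a b :=
  (intervalIntegrable_const (c := B)).mono_fun'
    ((measurable_pi_apply k).comp hv).aestronglyMeasurable
    (ae_of_all _ fun t => hB t k)

lemma intervalIntegrable_sum_mul (hv : Measurable v) (hB : ∀ t k, |v t k| ≤ B)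
    {g : ℝ → Fin K → ℝ} (hg : Continuous g) (a b : ℝ) :
    IntervalIntegrable (fun t => ∑ k, v t k * g t k) volume a b := by
  have h := IntervalIntegrable.sum Finset.univ (fun k _ =>
    (intervalIntegrable_coord hv hB k a b).mul_continuousOn
      (continuous_pi_iff.1 hg k).continuousOn)
  simpa only [Finset.sum_fn] using h

/-- The gain of exponential learning with a non-increasing learning rate dominates the final
value of the free energy. -/
lemma freeEnergy_le_integral [NeZero K] (hv : Measurable v) (hB : ∀ t k, |v t k| ≤ B)
    {γ : ℝ → ℝ} (hγ : Continuous γ) (hγ0 : ∀ t, 0 < γ t) (hanti : Antitone γ)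
    {y : ℝ → Fin K → ℝ} (hy : ∀ t k, y t k = ∫ s in (0 : ℝ)..t, v s k) {T : ℝ} (hT : 0 ≤ T) :
    freeEnergy (γ T) (y T) ≤ ∫ t in (0 : ℝ)..T, ∑ k, v t k * gibbs K (γ t • y t) k := by
  have hB0 : 0 ≤ B := (abs_nonneg _).trans (hB 0 0)
  have hyc : Continuous y := continuous_pi fun k => by
    simp only [hy]
    exact intervalIntegral.continuous_primitive (intervalIntegrable_coord hv hB k) 0
  have hqc : Continuous fun t => gibbs K (γ t • y t) := continuous_gibbs.comp (hγ.smul hyc)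
  have hvq := intervalIntegrable_sum_mul hv hB hqc
  have hFc : Continuous fun t => freeEnergy (γ t) (y t) := by
    unfold freeEnergy
    refine (hγ.inv₀ fun t => (hγ0 t).ne').mul (Continuous.sub (Continuous.log ?_ ?_) (by fun_prop))
    · fun_prop
    · exact fun t => (sum_exp_pos _).ne'
  have hWc : Continuous fun t => freeEnergy (γ t) (y t) -
      ∫ s in (0 : ℝ)..t, ∑ k, v s k * gibbs K (γ s • y s) k :=
    hFc.sub (intervalIntegral.continuous_primitive hvq 0)
  have key := image_le_of_liminf_slope_right_le_deriv_boundary (a := 0) (b := T)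
    hWc.continuousOn (B := fun _ => 0) (B' := fun _ => 0) ?_ continuousOn_const
    (fun x _ => hasDerivWithinAt_const _ _ _) ?_ (Set.right_mem_Icc.2 hT)
  · simpa [sub_nonpos] using key
  · have h0 : y 0 = 0 := by ext k; simp [hy]
    simp [h0, freeEnergy_zero]
  intro s _ r hr
  -- `D (t, u)` bounds the error of replacing the strategy at time `u` by its frozen-rate version.
  set D : ℝ × ℝ → ℝ := fun p => ∑ k, |gibbs K (γ s • y p.1) k - gibbs K (γ p.2 • y p.2) k| with hD
  have hDc : Continuous D := by
    have h1 : Continuous fun p : ℝ × ℝ => gibbs K (γ s • y p.1) :=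
      continuous_gibbs.comp ((hyc.comp continuous_fst).const_smul (γ s))
    have h2 : Continuous fun p : ℝ × ℝ => gibbs K (γ p.2 • y p.2) := hqc.comp continuous_snd
    exact continuous_finsetSum _ fun k _ =>
      (((continuous_apply k).comp h1).sub ((continuous_apply k).comp h2)).abs
  have hc : 0 < r / (B + 1) := by positivity
  obtain ⟨δ, hδ, hδD⟩ := Metric.continuousAt_iff.1 (hDc.continuousAt (x := (s, s))) _ hc
  have hDs : D (s, s) = 0 := by simp [hD]
  refine Eventually.frequently ?_
  filter_upwards [Ioo_mem_nhdsGT (show s < s + δ by linarith)] with t ht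
  have hst : 0 < t - s := sub_pos.2 ht.1
  have hincr : ∀ k, y t k - y s k = ∫ u in s..t, v u k := fun k => by
    rw [hy, hy]
    exact intervalIntegral.integral_interval_sub_left (intervalIntegrable_coord hv hB k _ _)
      (intervalIntegrable_coord hv hB k _ _)
  have hgain : (∫ u in (0 : ℝ)..t, ∑ k, v u k * gibbs K (γ u • y u) k) -
      (∫ u in (0 : ℝ)..s, ∑ k, v u k * gibbs K (γ u • y u) k) =
      ∫ u in s..t, ∑ k, v u k * gibbs K (γ u • y u) k :=
    intervalIntegral.integral_interval_sub_left (hvq _ _) (hvq _ _)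
  have hfroz := intervalIntegrable_sum_mul hv hB
    (continuous_const (y := gibbs K (γ s • y t))) s t
  have hlin : ∑ k, gibbs K (γ s • y t) k * (y t k - y s k) =
      ∫ u in s..t, ∑ k, v u k * gibbs K (γ s • y t) k := by
    rw [intervalIntegral.integral_finsetSum fun k _ =>
      (intervalIntegrable_coord hv hB k s t).mul_const _]
    refine Finset.sum_congr rfl fun k _ => ?_
    rw [intervalIntegral.integral_mul_const, hincr, mul_comm]
  have herr : (∫ u in s..t, ∑ k, v u k * gibbs K (γ s • y t) k) -
      (∫ u in s..t, ∑ k, v u k * gibbs K (γ u • y u) k) ≤ (t - s) * (B * (r / (B + 1))) := by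
    rw [← intervalIntegral.integral_sub hfroz (hvq _ _)]
    refine (intervalIntegral.integral_mono_on ht.1.le (hfroz.sub (hvq _ _))
      (intervalIntegrable_const (c := B * (r / (B + 1)))) fun u hu => ?_).trans_eq
        (by rw [intervalIntegral.integral_const, smul_eq_mul])
    have hdist : dist (t, u) (s, s) < δ := by
      rw [Prod.dist_eq, max_lt_iff, Real.dist_eq, Real.dist_eq, abs_lt, abs_lt]
      have := ht.2
      obtain ⟨h1, h2⟩ := hu
      refine ⟨⟨?_, ?_⟩, ?_, ?_⟩ <;> dsimp only <;> linarith
    have hDu : D (t, u) ≤ r / (B + 1) := by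
      have := hδD hdist
      rw [hDs, Real.dist_eq, sub_zero] at this
      exact (le_abs_self _).trans this.le
    calc (∑ k, v u k * gibbs K (γ s • y t) k) - ∑ k, v u k * gibbs K (γ u • y u) k
        = ∑ k, v u k * (gibbs K (γ s • y t) k - gibbs K (γ u • y u) k) := by
          simp only [mul_sub, Finset.sum_sub_distrib]
      _ ≤ ∑ k, B * |gibbs K (γ s • y t) k - gibbs K (γ u • y u) k| := by
          refine Finset.sum_le_sum fun k _ => (le_abs_self _).trans ?_
          rw [abs_mul]
          exact mul_le_mul_of_nonneg_right (hB u k) (abs_nonneg _)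
      _ = B * D (t, u) := by rw [hD, Finset.mul_sum]
      _ ≤ B * (r / (B + 1)) := mul_le_mul_of_nonneg_left hDu hB0
  have hBr : B * (r / (B + 1)) < r := by
    rw [mul_div_assoc', div_lt_iff₀ (by positivity)]
    linarith
  have hmono := freeEnergy_mono (hγ0 t) (hanti ht.1.le) (y t)
  have hconv := freeEnergy_sub_le (hγ0 s) (y s) (y t)
  rw [slope_def_field, div_lt_iff₀ hst]
  have := mul_lt_mul_of_pos_left hBr hst
  linarith

end BoundedStream

section Rate

variable {η : ℝ}

lemma gammaRate_eq (hη : 0 < η) (t : ℝ) : gammaRate η t = η / √(max 1 t) := by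
  unfold gammaRate
  split_ifs with h
  · rw [max_eq_left (by linarith)]
    simp
  · have ht : 0 < t := not_le.1 h
    rcases le_total t 1 with h1 | h1
    · rw [max_eq_left h1, Real.sqrt_one, div_one, min_eq_left]
      rw [le_div_iff₀ (Real.sqrt_pos.2 ht)]
      exact mul_le_of_le_one_right hη.le (Real.sqrt_le_one.2 h1)
    · rw [max_eq_right h1, min_eq_right]
      exact div_le_self hη.le (Real.one_le_sqrt.2 h1)

lemma sqrt_max_one_pos (t : ℝ) : 0 < √(max 1 t) :=
  Real.sqrt_pos.2 (zero_lt_one.trans_le (le_max_left 1 t))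

lemma gammaRate_pos (hη : 0 < η) (t : ℝ) : 0 < gammaRate η t := by
  rw [gammaRate_eq hη]
  exact div_pos hη (sqrt_max_one_pos t)

lemma continuous_gammaRate (hη : 0 < η) : Continuous (gammaRate η) := by
  rw [funext (gammaRate_eq hη)]
  exact continuous_const.div (by fun_prop) fun t => (sqrt_max_one_pos t).ne'

lemma antitone_gammaRate (hη : 0 < η) : Antitone (gammaRate η) := fun s t hst => by
  rw [gammaRate_eq hη, gammaRate_eq hη]
  exact div_le_div_of_nonneg_left hη.le (sqrt_max_one_pos s)
    (Real.sqrt_le_sqrt (max_le_max le_rfl hst))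

end Rate

/-- Continuous-time exponential learning on the simplex leads to regret at most
`η⁻¹ (log K) √T` against any fixed point of the simplex, for any stream of concave
payoff functions (encoded through the supergradient property of `v(t)`). -/
theorem continuous_time_exponential_learning_regret
    (K : ℕ) (hK : 1 ≤ K) (η : ℝ) (hη : 0 < η)
    (v : ℝ → Fin K → ℝ) (hv_meas : Measurable v)
    (hv_bdd : ∀ T > (0 : ℝ), ∃ B : ℝ, ∀ t ∈ Set.Icc (0 : ℝ) T, ‖v t‖ ≤ B)
    (y : ℝ → Fin K → ℝ) (hy : ∀ t : ℝ, y t = ∫ s in (0 : ℝ)..t, v s)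
    (q : ℝ → Fin K → ℝ) (hq : ∀ t : ℝ, q t = gibbs K (gammaRate η t • y t))
    (Φ : ℝ → (Fin K → ℝ) → ℝ)
    (hsup : ∀ t ∈ Set.Ici (0 : ℝ), ∀ q' ∈ stdSimplex ℝ (Fin K),
      Φ t q' ≤ Φ t (q t) + ∑ k, v t k * (q' k - q t k))
    (hint₁ : ∀ q₀ ∈ stdSimplex ℝ (Fin K),
      LocallyIntegrableOn (fun t => Φ t q₀) (Set.Ici (0 : ℝ)))
    (hint₂ : LocallyIntegrableOn (fun t => Φ t (q t)) (Set.Ici (0 : ℝ))) :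
    ∀ q₀ ∈ stdSimplex ℝ (Fin K), ∀ T : ℝ, 1 ≤ T →
      (∫ t in (0 : ℝ)..T, (Φ t q₀ - Φ t (q t))) ≤ η⁻¹ * Real.log K * Real.sqrt T := by
  intro q₀ hq₀ T hT
  have hT0 : 0 ≤ T := zero_le_one.trans hT
  have : NeZero K := ⟨by omega⟩
  obtain ⟨B, hB⟩ := hv_bdd T (by linarith)
  have hB0 : 0 ≤ B := (norm_nonneg _).trans (hB 0 ⟨le_rfl, hT0⟩)
  set w : ℝ → Fin K → ℝ := (Set.Icc 0 T).indicator v with hw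
  have hw_meas : Measurable w := hv_meas.indicator measurableSet_Icc
  have hwv : ∀ t ∈ Set.Icc 0 T, w t = v t := fun t ht => Set.indicator_of_mem ht v
  have hwB : ∀ t k, |w t k| ≤ B := fun t k => by
    by_cases ht : t ∈ Set.Icc 0 T
    · rw [hwv t ht]
      exact (norm_le_pi_norm (v t) k).trans (hB t ht)
    · simpa [hw, Set.indicator_of_notMem ht] using hB0
  set z : ℝ → Fin K → ℝ := fun t k => ∫ s in (0 : ℝ)..t, w s k with hz
  have hw_int : ∀ a b, IntervalIntegrable w volume a b := fun a b =>
    (intervalIntegrable_const (c := B)).mono_fun' hw_meas.aestronglyMeasurable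
      (ae_of_all _ fun t => (pi_norm_le_iff_of_nonneg hB0).2 (hwB t))
  have hyz : ∀ t ∈ Set.Icc 0 T, y t = z t := fun t ht => by
    have hvw : ∫ s in (0 : ℝ)..t, v s = ∫ s in (0 : ℝ)..t, w s :=
      intervalIntegral.integral_congr fun s hs => by
        rw [Set.uIcc_of_le ht.1] at hs
        exact (hwv s ⟨hs.1, hs.2.trans ht.2⟩).symm
    rw [hy, hvw]
    ext k
    exact ((ContinuousLinearMap.proj (R := ℝ) (φ := fun _ : Fin K => ℝ)
      k).intervalIntegral_comp_comm (hw_int 0 t)).symm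
  have hγc := continuous_gammaRate hη
  have hzc : Continuous z := continuous_pi fun k =>
    intervalIntegral.continuous_primitive (intervalIntegrable_coord hw_meas hwB k) 0
  have hpc : Continuous fun t => gibbs K (gammaRate η t • z t) :=
    continuous_gibbs.comp (hγc.smul hzc)
  have hgain := (sum_mul_sub_le_freeEnergy (gammaRate_pos hη T) (z T) hq₀).trans
    (freeEnergy_le_integral hw_meas hwB hγc (gammaRate_pos hη) (antitone_gammaRate hη)
      (fun _ _ => rfl) hT0)
  have hq₀_int := intervalIntegrable_sum_mul hw_meas hwB (continuous_const (y := q₀)) 0 T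
  have hp_int := intervalIntegrable_sum_mul hw_meas hwB hpc 0 T
  have hlin : ∫ t in (0 : ℝ)..T, ∑ k, w t k * q₀ k = ∑ k, q₀ k * z T k := by
    rw [intervalIntegral.integral_finsetSum fun k _ =>
      (intervalIntegrable_coord hw_meas hwB k 0 T).mul_const _]
    refine Finset.sum_congr rfl fun k _ => ?_
    rw [intervalIntegral.integral_mul_const, mul_comm]
  have hΦ_int : ∀ {f : ℝ → ℝ}, LocallyIntegrableOn f (Set.Ici 0) →
      IntervalIntegrable f volume 0 T := fun hf =>
    (intervalIntegrable_iff_integrableOn_Icc_of_le hT0).2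
      (hf.integrableOn_compact_subset Set.Icc_subset_Ici_self isCompact_Icc)
  have hmono := intervalIntegral.integral_mono_on hT0 ((hΦ_int (hint₁ q₀ hq₀)).sub (hΦ_int hint₂))
    (hq₀_int.sub hp_int) fun t ht => by
      have h := hsup t ht.1 q₀ hq₀
      rw [← Finset.sum_sub_distrib]
      simp only [← mul_sub]
      rw [hwv t ht, ← hyz t ht, ← hq]
      linarith
  rw [intervalIntegral.integral_sub hq₀_int hp_int, hlin] at hmono
  have hrate : (gammaRate η T)⁻¹ * Real.log K = η⁻¹ * Real.log K * √T := by
    rw [gammaRate_eq hη, max_eq_right hT, inv_div]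
    ring
  linarith
end

section
/- Let K ≥ 1, let P_k > 0 for k = 1, …, K, let 0 < P < ∑_{k=1}^K P_k, let X₀ = {p ∈ ℝ^K : 0 ≤ p_k ≤ P_k for all k, ∑_{k=1}^K p_k = P}, and let h₀(p) = ∑_{k=1}^K [p_k log p_k + (P_k − p_k) log(P_k − p_k)]. Then for every y ∈ ℝ^K the function p ↦ ⟨y, p⟩ − h₀(p) admits a unique maximizer G₀(y) over X₀; this maximizer satisfies 0 < G₀,k(y) < P_k for all k, and there exists λ ∈ ℝ such that G₀,k(y) = P_k (1 + e^{λ − y_k})^{−1} for every k = 1, …, K. -/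
/-- The set `X₀` of admissible power allocation vectors under a total power budget `P`
and per-channel caps `P_k`. -/
def powSet (K : ℕ) (Pmax : Fin K → ℝ) (P : ℝ) : Set (Fin K → ℝ) :=
  {p | (∀ k, 0 ≤ p k ∧ p k ≤ Pmax k) ∧ ∑ k, p k = P}

/-- The modified entropy `h₀(p) = ∑_k [p_k log p_k + (P_k − p_k) log(P_k − p_k)]`,
with the convention `0 log 0 = 0`. -/
noncomputable def modEntropy (K : ℕ) (Pmax : Fin K → ℝ) (p : Fin K → ℝ) : ℝ :=
  ∑ k, (p k * Real.log (p k) + (Pmax k - p k) * Real.log (Pmax k - p k))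

/-- Strict Gibbs inequality for a single pair of weights. -/
theorem sub_lt_mul_log_sub_log {x q : ℝ} (hx : 0 ≤ x) (hq : 0 < q) (hne : x ≠ q) :
    x - q < x * (Real.log x - Real.log q) := by
  rcases hx.eq_or_lt with rfl | hx
  · simpa using hq
  · have h := Real.log_lt_sub_one_of_pos (div_pos hq hx)
      (by rw [Ne, div_eq_one_iff_eq hx.ne']; exact hne.symm)
    rw [Real.log_div hq.ne' hx.ne'] at h
    have h2 := mul_lt_mul_of_pos_left h hx
    have h3 : x * (q / x - 1) = q - x := by field_simp
    linarith

/-- The scalar entropy-regularized payoff lies strictly below its tangent line of slope `l` at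
the logistic point `q = a (1 + e^{l - y})⁻¹`. -/
theorem logistic_payoff_lt {a q x y l : ℝ} (hx : 0 ≤ x) (hxa : x ≤ a) (hq : 0 < q) (hqa : q < a)
    (hy : y = l + Real.log q - Real.log (a - q)) (hne : x ≠ q) :
    y * x - (x * Real.log x + (a - x) * Real.log (a - x)) <
      y * q - (q * Real.log q + (a - q) * Real.log (a - q)) + l * (x - q) := by
  have h1 := sub_lt_mul_log_sub_log hx hq hne
  have h2 := sub_lt_mul_log_sub_log (sub_nonneg.2 hxa) (sub_pos.2 hqa)
    (fun h => hne (by linarith))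
  subst hy
  linarith

theorem logistic_slope_eq {a : ℝ} (ha : 0 < a) (y l : ℝ) :
    y = l + Real.log (a * (1 + Real.exp (l - y))⁻¹) -
      Real.log (a - a * (1 + Real.exp (l - y))⁻¹) := by
  have he := Real.exp_pos (l - y)
  have h : a - a * (1 + Real.exp (l - y))⁻¹ =
      a * (1 + Real.exp (l - y))⁻¹ * Real.exp (l - y) := by
    field_simp
    ring
  rw [h, Real.log_mul (by positivity) he.ne', Real.log_exp]
  ring

theorem logistic_mem_Ioo {a : ℝ} (ha : 0 < a) (t : ℝ) :
    a * (1 + Real.exp t)⁻¹ ∈ Set.Ioo 0 a := by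
  have he := Real.exp_pos t
  exact ⟨by positivity, mul_lt_of_lt_one_right ha (inv_lt_one_of_one_lt₀ (by linarith))⟩

/-- The total logistic allocation attains every budget strictly between `0` and the sum of the
caps. -/
theorem exists_sum_logistic_eq {ι : Type*} [Fintype ι] (a y : ι → ℝ) {P : ℝ}
    (hP0 : 0 < P) (hP : P < ∑ k, a k) :
    ∃ l : ℝ, ∑ k, a k * (1 + Real.exp (l - y k))⁻¹ = P := by
  have hcont : Continuous fun l : ℝ => ∑ k, a k * (1 + Real.exp (l - y k))⁻¹ := by
    refine continuous_finsetSum _ fun k _ => continuous_const.mul (Continuous.inv₀ ?_ ?_)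
    · fun_prop
    · exact fun l => by positivity
  have hbot : Filter.Tendsto (fun l : ℝ => ∑ k, a k * (1 + Real.exp (l - y k))⁻¹)
      Filter.atBot (nhds (∑ k, a k)) := by
    refine tendsto_finsetSum _ fun k _ => ?_
    have h := Real.tendsto_exp_atBot.comp
      (Filter.tendsto_atBot_add_const_right Filter.atBot (-y k) Filter.tendsto_id)
    simpa [sub_eq_add_neg] using ((h.const_add 1).inv₀ (by norm_num)).const_mul (a k)
  have htop : Filter.Tendsto (fun l : ℝ => ∑ k, a k * (1 + Real.exp (l - y k))⁻¹)
      Filter.atTop (nhds 0) := by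
    rw [← Finset.sum_const_zero (s := (Finset.univ : Finset ι))]
    refine tendsto_finsetSum _ fun k _ => ?_
    have h := Real.tendsto_exp_atTop.comp
      (Filter.tendsto_atTop_add_const_right Filter.atTop (-y k) Filter.tendsto_id)
    simpa [sub_eq_add_neg] using
      (Filter.tendsto_atTop_add_const_left _ 1 h).inv_tendsto_atTop.const_mul (a k)
  obtain ⟨u, hu⟩ := (hbot.eventually_const_lt hP).exists
  obtain ⟨v, hv⟩ := (htop.eventually_lt_const hP0).exists
  exact mem_range_of_exists_le_of_exists_ge hcont ⟨v, hv.le⟩ ⟨u, hu.le⟩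

/-- For every `y ∈ ℝ^K`, the function `p ↦ ⟨y, p⟩ − h₀(p)` admits a unique maximizer
`G₀(y)` over `X₀`; the maximizer lies in the interior (`0 < G₀,k(y) < P_k`) and has the
water-filling form `G₀,k(y) = P_k (1 + e^{λ − y_k})⁻¹` for some `λ ∈ ℝ`. -/
theorem modified_gibbs_unique_maximizer
    (K : ℕ) (hK : 1 ≤ K) (Pmax : Fin K → ℝ) (hPmax : ∀ k, 0 < Pmax k)
    (P : ℝ) (hP0 : 0 < P) (hPsum : P < ∑ k, Pmax k) (y : Fin K → ℝ) :
    ∃ g ∈ powSet K Pmax P,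
      IsMaxOn (fun p : Fin K → ℝ => (∑ k, y k * p k) - modEntropy K Pmax p)
        (powSet K Pmax P) g ∧
      (∀ p ∈ powSet K Pmax P,
        IsMaxOn (fun p : Fin K → ℝ => (∑ k, y k * p k) - modEntropy K Pmax p)
          (powSet K Pmax P) p → p = g) ∧
      (∀ k, 0 < g k ∧ g k < Pmax k) ∧
      (∃ lam : ℝ, ∀ k, g k = Pmax k * (1 + Real.exp (lam - y k))⁻¹) := by
  obtain ⟨l, hl⟩ := exists_sum_logistic_eq Pmax y hP0 hPsum
  set g : Fin K → ℝ := fun k => Pmax k * (1 + Real.exp (l - y k))⁻¹ with hg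
  have hint (k : Fin K) : 0 < g k ∧ g k < Pmax k := logistic_mem_Ioo (hPmax k) _
  have hgmem : g ∈ powSet K Pmax P := ⟨fun k => ⟨(hint k).1.le, (hint k).2.le⟩, hl⟩
  have hlt : ∀ p ∈ powSet K Pmax P, p ≠ g →
      (∑ k, y k * p k) - modEntropy K Pmax p < (∑ k, y k * g k) - modEntropy K Pmax g := by
    intro p hp hne
    have hcoord (k : Fin K) (hk : p k ≠ g k) :=
      logistic_payoff_lt (hp.1 k).1 (hp.1 k).2 (hint k).1 (hint k).2
        (logistic_slope_eq (hPmax k) (y k) l) hk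
    obtain ⟨j, hj⟩ := Function.ne_iff.1 hne
    have hle (k : Fin K) :
        y k * p k - (p k * Real.log (p k) + (Pmax k - p k) * Real.log (Pmax k - p k)) ≤
          y k * g k - (g k * Real.log (g k) + (Pmax k - g k) * Real.log (Pmax k - g k)) +
            l * (p k - g k) := by
      by_cases hk : p k = g k
      · simp [hk]
      · exact (hcoord k hk).le
    have hsum := Finset.sum_lt_sum (fun k _ => hle k) ⟨j, Finset.mem_univ j, hcoord j hj⟩
    rw [Finset.sum_add_distrib, ← Finset.mul_sum, Finset.sum_sub_distrib p g, hp.2, hgmem.2,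
      sub_self, mul_zero, add_zero, Finset.sum_sub_distrib, Finset.sum_sub_distrib] at hsum
    exact hsum
  refine ⟨g, hgmem, fun p hp => ?_, fun p hp hmax => ?_, hint, l, fun k => rfl⟩
  · rcases eq_or_ne p g with h | hne
    · exact (congrArg (fun p => (∑ k, y k * p k) - modEntropy K Pmax p) h).le
    · exact (hlt p hp hne).le
  · by_contra hne
    exact (hlt p hp hne).not_ge (hmax hgmem)
end

section
/- Fix K ≥ 1, η > 0, P_k > 0, 0 < P < ∑_{k=1}^K P_k, and set γ(t) = min{η, η t^{−1/2}} for t > 0 with γ(0) = η; let X₀, h₀ and the modified Gibbs map G₀ be as in the constrained power allocation setting. There exists a constant C > 0, depending only on K, P, (P_k)_{k=1}^K and η, with the following property: if v : [0, ∞) → ℝ^K is measurable and bounded on compact intervals, y(t) = ∫₀^t v(s) ds, p(t) = G₀(γ(t) y(t)) ∈ X₀, and for (almost) every t ≥ 0 there is Φ_t : X₀ → ℝ such that v(t) is a supergradient of Φ_t at p(t) and t ↦ Φ_t(p₀), t ↦ Φ_t(p(t)) are locally integrable, then for every p₀ ∈ X₀ and every T ≥ 1, ∫₀^T [Φ_t(p₀)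 − Φ_t(p(t))] dt ≤ C √T. -/
open MeasureTheory

open Filter Topology

lemma continuous_modEntropy (K : ℕ) (Pmax : Fin K → ℝ) : Continuous (modEntropy K Pmax) := by
  unfold modEntropy
  refine continuous_finsetSum _ fun k _ => ?_
  exact (Real.continuous_mul_log.comp (continuous_apply k)).add
    (Real.continuous_mul_log.comp (continuous_const.sub (continuous_apply k)))

lemma isCompact_powSet (K : ℕ) (Pmax : Fin K → ℝ) (P : ℝ) : IsCompact (powSet K Pmax P) := by
  have hset : powSet K Pmax P = Set.Icc 0 Pmax ∩ {p | ∑ k, p k = P} := by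
    ext p
    simp [powSet, Pi.le_def, forall_and]
  rw [hset]
  exact isCompact_Icc.inter_right
    (isClosed_eq (continuous_finsetSum _ fun k _ => continuous_apply k) continuous_const)

lemma convex_powSet (K : ℕ) (Pmax : Fin K → ℝ) (P : ℝ) : Convex ℝ (powSet K Pmax P) := by
  rintro p ⟨hp, hpP⟩ q ⟨hq, hqP⟩ a b ha hb hab
  refine ⟨fun k => ?_, ?_⟩
  · exact convex_Icc 0 (Pmax k) (hp k) (hq k) ha hb hab
  · simp only [Pi.add_apply, Pi.smul_apply, smul_eq_mul, Finset.sum_add_distrib,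
      ← Finset.mul_sum, hpP, hqP]
    rw [← add_mul, hab, one_mul]

lemma strictConvexOn_mul_log_add_sub_mul_log (c : ℝ) :
    StrictConvexOn ℝ (Set.Icc 0 c) fun x : ℝ => x * Real.log x + (c - x) * Real.log (c - x) := by
  refine (Real.strictConvexOn_mul_log.subset Set.Icc_subset_Ici_self
    (convex_Icc 0 c)).add_convexOn ⟨convex_Icc 0 c, ?_⟩
  intro x hx y hy a b ha hb hab
  have h := Real.convexOn_mul_log.2 (Set.mem_Ici.2 (sub_nonneg.2 hx.2))
    (Set.mem_Ici.2 (sub_nonneg.2 hy.2)) ha hb hab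
  have hc : a • (c - x) + b • (c - y) = c - (a • x + b • y) := by
    simp only [smul_eq_mul]
    linear_combination c * hab
  rwa [hc] at h

lemma strictConvexOn_modEntropy (K : ℕ) (Pmax : Fin K → ℝ) (P : ℝ) :
    StrictConvexOn ℝ (powSet K Pmax P) (modEntropy K Pmax) := by
  refine ⟨convex_powSet K Pmax P, fun p hp q hq hpq a b ha hb hab => ?_⟩
  obtain ⟨j, hj⟩ := Function.ne_iff.1 hpq
  simp only [modEntropy, smul_eq_mul, Finset.mul_sum, ← Finset.sum_add_distrib]
  refine Finset.sum_lt_sum (fun k _ => ?_) ⟨j, Finset.mem_univ j, ?_⟩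
  · exact (strictConvexOn_mul_log_add_sub_mul_log (Pmax k)).convexOn.2 (hp.1 k) (hq.1 k)
      ha.le hb.le hab
  · exact (strictConvexOn_mul_log_add_sub_mul_log (Pmax j)).2 (hp.1 j) (hq.1 j) hj ha hb hab

/-- Any map selecting maximizers of the entropy-regularized linear functional is continuous. -/
lemma continuous_of_isMaxOn_modEntropy {K : ℕ} {Pmax : Fin K → ℝ} {P : ℝ}
    {G : (Fin K → ℝ) → (Fin K → ℝ)} (hmem : ∀ y, G y ∈ powSet K Pmax P)
    (hmax : ∀ y, IsMaxOn (fun p : Fin K → ℝ => (∑ k, y k * p k) - modEntropy K Pmax p)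
      (powSet K Pmax P) (G y)) : Continuous G := by
  have hunique (y q : Fin K → ℝ) (hq : q ∈ powSet K Pmax P)
      (hqmax : IsMaxOn (fun p : Fin K → ℝ => (∑ k, y k * p k) - modEntropy K Pmax p)
        (powSet K Pmax P) q) : q = G y := by
    have hconc : StrictConcaveOn ℝ (powSet K Pmax P)
        (fun p : Fin K → ℝ => (∑ k, y k * p k) - modEntropy K Pmax p) := by
      simp only [sub_eq_add_neg]
      refine ConcaveOn.add_strictConcaveOn ⟨convex_powSet K Pmax P, ?_⟩
        (strictConvexOn_modEntropy K Pmax P).neg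
      intro p _ q _ a b _ _ _
      simp only [smul_eq_mul, Finset.mul_sum, ← Finset.sum_add_distrib, Pi.add_apply,
        Pi.smul_apply]
      exact (Finset.sum_congr rfl fun k _ => by ring).le
    exact hconc.eq_of_isMaxOn hqmax (hmax y) hq (hmem y)
  refine continuous_iff_continuousAt.2 fun y => ?_
  refine (isCompact_powSet K Pmax P).tendsto_nhds_of_unique_mapClusterPt
    (Eventually.of_forall hmem) fun q hq hcl => hunique y q hq fun p hp => ?_
  obtain ⟨U, hU, hGU⟩ := mapClusterPt_iff_ultrafilter.1 hcl
  have hyk (k : Fin K) : Tendsto (fun z : Fin K → ℝ => z k) U (𝓝 (y k)) :=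
    ((continuous_apply k).tendsto y).mono_left hU
  have hGk (k : Fin K) : Tendsto (fun z => G z k) U (𝓝 (q k)) :=
    ((continuous_apply k).tendsto q).comp hGU
  refine le_of_tendsto_of_tendsto' (b := (U : Filter (Fin K → ℝ)))
    (f := fun z => (∑ k, z k * p k) - modEntropy K Pmax p)
    (g := fun z => (∑ k, z k * G z k) - modEntropy K Pmax (G z)) ?_ ?_ fun z => isMaxOn_iff.1 (hmax z) p hp
  · exact (tendsto_finsetSum _ fun k _ => (hyk k).mul_const _).sub_const _
  · exact (tendsto_finsetSum _ fun k _ => (hyk k).mul (hGk k)).sub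
      (((continuous_modEntropy K Pmax).tendsto q).comp hGU)

lemma gammaRate_eq_div_max (η t : ℝ) (hη : 0 < η) : gammaRate η t = η / max 1 √t := by
  unfold gammaRate
  split_ifs with ht
  · simp [Real.sqrt_eq_zero_of_nonpos ht]
  · have hs : 0 < √t := Real.sqrt_pos.2 (not_le.1 ht)
    rcases le_total 1 √t with h | h
    · rw [max_eq_right h, min_eq_right (div_le_self hη.le h)]
    · rw [max_eq_left h, div_one, min_eq_left]
      rw [le_div_iff₀ hs]
      exact mul_le_of_le_one_right hη.le h

/-- A local linear bound on the increments of a function, uniform over short intervals,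
holds on the whole interval. -/
lemma sub_le_mul_of_forall_sub_lt {D : ℝ → ℝ} {T ε δ : ℝ} (hT : 0 ≤ T) (hδ : 0 < δ)
    (h : ∀ s t, 0 ≤ s → s ≤ t → t ≤ T → t - s < δ → D t - D s ≤ ε * (t - s)) :
    D T - D 0 ≤ ε * T := by
  obtain ⟨n, hn⟩ := exists_nat_gt (T / δ)
  have hn0 : (0 : ℝ) < n := (div_nonneg hT hδ.le).trans_lt hn
  have hsum := Finset.sum_range_sub (fun i : ℕ => D (i * (T / n))) n
  rw [Nat.cast_zero, zero_mul, mul_div_cancel₀ T hn0.ne'] at hsum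
  rw [← hsum]
  have hstep : ∀ i ∈ Finset.range n,
      D ((i + 1 : ℕ) * (T / n)) - D (i * (T / n)) ≤ ε * (T / n) := by
    intro i hi
    have hTn : 0 ≤ T / n := div_nonneg hT hn0.le
    have hd : ((i + 1 : ℕ) : ℝ) * (T / n) - i * (T / n) = T / n := by push_cast; ring
    have hin : ((i + 1 : ℕ) : ℝ) ≤ n := by exact_mod_cast Finset.mem_range.1 hi
    have := h (i * (T / n)) ((i + 1 : ℕ) * (T / n)) (by positivity) (by linarith)
      ((mul_le_mul_of_nonneg_right hin hTn).trans_eq (mul_div_cancel₀ T hn0.ne'))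
      (by rw [hd]; exact (div_lt_comm₀ hδ hn0).1 hn)
    rwa [hd] at this
  refine (Finset.sum_le_sum hstep).trans_eq ?_
  rw [Finset.sum_const, Finset.card_range, nsmul_eq_mul]
  field_simp

/-- Continuous-time exponential learning with the modified Gibbs map `G₀` on the
constrained set `X₀` leads to regret at most `C √T` for a constant `C` depending only on
`K`, `P`, `(P_k)` and `η`. -/
theorem continuous_time_modified_exponential_learning_regret
    (K : ℕ) (hK : 1 ≤ K) (η : ℝ) (hη : 0 < η)
    (Pmax : Fin K → ℝ) (hPmax : ∀ k, 0 < Pmax k)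
    (P : ℝ) (hP0 : 0 < P) (hPsum : P < ∑ k, Pmax k)
    (G₀ : (Fin K → ℝ) → (Fin K → ℝ))
    (hG₀mem : ∀ y, G₀ y ∈ powSet K Pmax P)
    (hG₀max : ∀ y, IsMaxOn (fun p : Fin K → ℝ => (∑ k, y k * p k) - modEntropy K Pmax p)
      (powSet K Pmax P) (G₀ y)) :
    ∃ C > (0 : ℝ),
      ∀ (v : ℝ → Fin K → ℝ), Measurable v →
      (∀ T > (0 : ℝ), ∃ B : ℝ, ∀ t ∈ Set.Icc (0 : ℝ) T, ‖v t‖ ≤ B) →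
      ∀ (y : ℝ → Fin K → ℝ), (∀ t : ℝ, y t = ∫ s in (0 : ℝ)..t, v s) →
      ∀ (p : ℝ → Fin K → ℝ), (∀ t : ℝ, p t = G₀ (gammaRate η t • y t)) →
      ∀ (Φ : ℝ → (Fin K → ℝ) → ℝ),
      (∀ t ∈ Set.Ici (0 : ℝ), ∀ p' ∈ powSet K Pmax P,
        Φ t p' ≤ Φ t (p t) + ∑ k, v t k * (p' k - p t k)) →
      (∀ p₀ ∈ powSet K Pmax P,
        LocallyIntegrableOn (fun t => Φ t p₀) (Set.Ici (0 : ℝ))) →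
      LocallyIntegrableOn (fun t => Φ t (p t)) (Set.Ici (0 : ℝ)) →
      ∀ p₀ ∈ powSet K Pmax P, ∀ T : ℝ, 1 ≤ T →
        (∫ t in (0 : ℝ)..T, (Φ t p₀ - Φ t (p t))) ≤ C * Real.sqrt T := by
  have hGcont := continuous_of_isMaxOn_modEntropy hG₀mem hG₀max
  set h := modEntropy K Pmax
  obtain ⟨M, hM⟩ := (isCompact_powSet K Pmax P).bddAbove_image
    (continuous_modEntropy K Pmax).continuousOn
  replace hM (q) (hq : q ∈ powSet K Pmax P) : h q ≤ M := hM ⟨q, hq, rfl⟩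
  set m := h (G₀ 0)
  have hmin (q) (hq : q ∈ powSet K Pmax P) : m ≤ h q := by
    have := hG₀max 0 hq
    simpa using this
  have hmM : m ≤ M := hM _ (hG₀mem 0)
  refine ⟨(M - m) / η + 1, by have := div_nonneg (sub_nonneg.2 hmM) hη.le; linarith, ?_⟩
  intro v hv hvb y hy p hp Φ hΦ hΦ₀ hΦp p₀ hp₀ T hT
  have hT0 : (0 : ℝ) < T := by linarith
  obtain ⟨B, hB⟩ := hvb T hT0
  have hBk (t : ℝ) (ht : t ∈ Set.Icc 0 T) (k : Fin K) : |v t k| ≤ B :=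
    (norm_le_pi_norm (v t) k).trans (hB t ht)
  have hB0 : 0 ≤ B := (norm_nonneg _).trans (hB 0 ⟨le_rfl, hT0.le⟩)
  have hpmem (t : ℝ) : p t ∈ powSet K Pmax P := hp t ▸ hG₀mem _
  have hvint : IntegrableOn v (Set.Icc 0 T) :=
    Measure.integrableOn_of_bounded (M := B) (by simp) hv.aestronglyMeasurable
      ((ae_restrict_iff' measurableSet_Icc).2 (Eventually.of_forall hB))
  have hvkint (k : Fin K) : IntegrableOn (fun t => v t k) (Set.Icc 0 T) := hvint.eval k
  have hsub {s t : ℝ} (hs : s ∈ Set.Icc 0 T) (ht : t ∈ Set.Icc 0 T) :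
      Set.uIcc s t ⊆ Set.Icc 0 T := Set.ordConnected_Icc.uIcc_subset hs ht
  have hII {f : ℝ → ℝ} (hf : IntegrableOn f (Set.Icc 0 T)) {s t : ℝ} (hs : s ∈ Set.Icc 0 T)
      (ht : t ∈ Set.Icc 0 T) : IntervalIntegrable f volume s t :=
    (hf.mono_set (hsub hs ht)).intervalIntegrable
  have h0mem : (0 : ℝ) ∈ Set.Icc 0 T := ⟨le_rfl, hT0.le⟩
  have hTmem : T ∈ Set.Icc 0 T := ⟨hT0.le, le_rfl⟩
  have hyk (t : ℝ) (ht : t ∈ Set.Icc 0 T) (k : Fin K) : y t k = ∫ s in (0 : ℝ)..t, v s k := by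
    rw [hy t]
    let π : (Fin K → ℝ) →L[ℝ] ℝ := ContinuousLinearMap.proj k
    exact (π.intervalIntegral_comp_comm
      (hvint.mono_set (hsub h0mem ht)).intervalIntegrable).symm
  have hycont : ContinuousOn y (Set.Icc 0 T) := by
    have := intervalIntegral.continuousOn_primitive_interval (a := 0) (b := T) (μ := volume)
      (f := v) (by rwa [Set.uIcc_of_le hT0.le])
    rw [Set.uIcc_of_le hT0.le] at this
    exact this.congr fun t _ => hy t
  set r : ℝ → ℝ := fun t => max 1 √t / η with hr
  have hrpos (t : ℝ) : 0 < r t := div_pos (lt_max_of_lt_left one_pos) hη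
  have hrmono {s t : ℝ} (hst : s ≤ t) : r s ≤ r t := by
    simp only [hr]
    gcongr
  have hγr (t : ℝ) : gammaRate η t = (r t)⁻¹ := by
    rw [gammaRate_eq_div_max η t hη, hr, inv_div]
  have hpcont : ContinuousOn p (Set.Icc 0 T) := by
    have hr' : Continuous r := by fun_prop
    have : ContinuousOn (fun t => G₀ ((r t)⁻¹ • y t)) (Set.Icc 0 T) :=
      hGcont.comp_continuousOn
        ((hr'.inv₀ fun t => (hrpos t).ne').continuousOn.smul hycont)
    exact this.congr fun t _ => by rw [hp t, hγr]
  have hopt (t : ℝ) (q) (hq : q ∈ powSet K Pmax P) :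
      ∑ k, y t k * q k - r t * (h q - m) ≤ ∑ k, y t k * p t k - r t * (h (p t) - m) := by
    have hmax := isMaxOn_iff.1 (hG₀max (gammaRate η t • y t)) q hq
    rw [← hp t] at hmax
    simp only [hγr, Pi.smul_apply, smul_eq_mul, mul_assoc, ← Finset.mul_sum] at hmax
    have := mul_le_mul_of_nonneg_left hmax (hrpos t).le
    simp only [mul_sub, mul_inv_cancel_left₀ (hrpos t).ne'] at this
    linarith
  have hvpint : IntegrableOn (fun t => ∑ k, v t k * p t k) (Set.Icc 0 T) :=
    integrable_finsetSum _ fun k _ =>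
      (hvkint k).mul_continuousOn ((continuous_apply k).comp_continuousOn hpcont) isCompact_Icc
  have hvqint (q : Fin K → ℝ) : IntegrableOn (fun t => ∑ k, v t k * q k) (Set.Icc 0 T) :=
    integrable_finsetSum _ fun k _ => (hvkint k).mul_const _
  have hyq {s t : ℝ} (hs : s ∈ Set.Icc 0 T) (ht : t ∈ Set.Icc 0 T) (q : Fin K → ℝ) :
      ∑ k, y t k * q k - ∑ k, y s k * q k = ∫ u in s..t, ∑ k, v u k * q k := by
    rw [intervalIntegral.integral_finsetSum fun k _ => (hII (hvkint k) hs ht).mul_const _,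
      ← Finset.sum_sub_distrib]
    refine Finset.sum_congr rfl fun k _ => ?_
    rw [intervalIntegral.integral_mul_const, ← sub_mul, hyk t ht, hyk s hs,
      intervalIntegral.integral_interval_sub_left (hII (hvkint k) h0mem ht)
        (hII (hvkint k) h0mem hs)]
  set F : ℝ → ℝ := fun t => ∑ k, y t k * p t k - r t * (h (p t) - m) with hF
  set D : ℝ → ℝ := fun t => F t - ∫ u in (0 : ℝ)..t, ∑ k, v u k * p u k with hD
  have hDstep {s t : ℝ} (hs : s ∈ Set.Icc 0 T) (ht : t ∈ Set.Icc 0 T) (hst : s ≤ t) :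
      D t - D s ≤ ∫ u in s..t, ∑ k, v u k * (p t k - p u k) := by
    have h1 := hopt s (p t) (hpmem t)
    have h2 := mul_le_mul_of_nonneg_right (hrmono hst) (sub_nonneg.2 (hmin _ (hpmem t)))
    have h3 := hyq hs ht (p t)
    have h4 := intervalIntegral.integral_interval_sub_left (hII hvpint h0mem ht)
      (hII hvpint h0mem hs)
    simp only [mul_sub, Finset.sum_sub_distrib]
    rw [intervalIntegral.integral_sub (hII (hvqint (p t)) hs ht) (hII hvpint hs ht), ← h3, ← h4]
    simp only [hD, hF]
    linarith
  have hDle (ε : ℝ) (hε : 0 < ε) : D T - D 0 ≤ (∑ _k : Fin K, B * ε) * T := by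
    obtain ⟨δ, hδ, hδp⟩ := Metric.uniformContinuousOn_iff.1
      (isCompact_Icc.uniformContinuousOn_of_continuous hpcont) ε hε
    refine sub_le_mul_of_forall_sub_lt hT0.le hδ fun s t hs hst htT hd => ?_
    have hs' : s ∈ Set.Icc 0 T := ⟨hs, hst.trans htT⟩
    have ht' : t ∈ Set.Icc 0 T := ⟨hs.trans hst, htT⟩
    refine (hDstep hs' ht' hst).trans ((Real.le_norm_self _).trans ?_)
    rw [← abs_of_nonneg (sub_nonneg.2 hst)]
    refine intervalIntegral.norm_integral_le_of_norm_le_const fun u hu => ?_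
    rw [Set.uIoc_of_le hst] at hu
    have hu' : u ∈ Set.Icc 0 T := ⟨hs.trans hu.1.le, hu.2.trans htT⟩
    refine norm_sum_le_of_le _ fun k _ => ?_
    rw [norm_mul]
    refine mul_le_mul (hBk u hu' k) ?_ (norm_nonneg _) hB0
    have hclose : dist (p t) (p u) < ε := hδp t ht' u hu' (by
      rw [Real.dist_eq, abs_of_nonneg (sub_nonneg.2 hu.2)]
      linarith [hu.1])
    exact ((dist_eq_norm (p t k) (p u k)).symm.trans_le (dist_le_pi_dist _ _ k)).trans hclose.le
  have hDT : D T ≤ D 0 := by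
    have htend : Tendsto (fun ε : ℝ => (∑ _k : Fin K, B * ε) * T) (𝓝[>] 0) (𝓝 0) := by
      have hc : Continuous fun ε : ℝ => (∑ _k : Fin K, B * ε) * T := by fun_prop
      simpa using (hc.tendsto 0).mono_left nhdsWithin_le_nhds
    exact sub_nonpos.1 (ge_of_tendsto htend (eventually_mem_nhdsWithin.mono hDle))
  have hD0 : D 0 ≤ 0 := by
    have hy0 : y 0 = 0 := by rw [hy, intervalIntegral.integral_same]
    have := mul_nonneg (hrpos 0).le (sub_nonneg.2 (hmin _ (hpmem 0)))
    simpa [hD, hF, hy0] using this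
  have hlin : ∫ t in (0 : ℝ)..T, ∑ k, v t k * (p₀ k - p t k) ≤ r T * (h p₀ - m) := by
    have h1 := hopt T p₀ hp₀
    have h3 := hyq h0mem hTmem p₀
    have hy0 : y 0 = 0 := by rw [hy, intervalIntegral.integral_same]
    simp only [hy0, Pi.zero_apply, zero_mul, Finset.sum_const_zero, sub_zero] at h3
    simp only [mul_sub, Finset.sum_sub_distrib]
    rw [intervalIntegral.integral_sub (hII (hvqint p₀) h0mem hTmem) (hII hvpint h0mem hTmem),
      ← h3]
    simp only [hD, hF] at hDT hD0
    linarith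
  have hΦint : IntervalIntegrable (fun t => Φ t p₀ - Φ t (p t)) volume 0 T :=
    hII (((hΦ₀ p₀ hp₀).integrableOn_compact_subset Set.Icc_subset_Ici_self isCompact_Icc).sub
      (hΦp.integrableOn_compact_subset Set.Icc_subset_Ici_self isCompact_Icc)) h0mem hTmem
  have hlinint : IntervalIntegrable (fun t => ∑ k, v t k * (p₀ k - p t k)) volume 0 T := by
    simp only [mul_sub, Finset.sum_sub_distrib]
    exact hII ((hvqint p₀).sub hvpint) h0mem hTmem
  calc ∫ t in (0 : ℝ)..T, (Φ t p₀ - Φ t (p t))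
      ≤ ∫ t in (0 : ℝ)..T, ∑ k, v t k * (p₀ k - p t k) :=
        intervalIntegral.integral_mono_on hT0.le hΦint hlinint fun t ht =>
          sub_le_iff_le_add'.2 (hΦ t ht.1 p₀ hp₀)
    _ ≤ r T * (h p₀ - m) := hlin
    _ ≤ r T * (M - m) := by
        have := hM p₀ hp₀
        have := (hrpos T).le
        gcongr
    _ = (M - m) / η * √T := by
        simp only [hr]
        rw [max_eq_right (Real.one_le_sqrt.2 hT)]
        ring
    _ ≤ ((M - m) / η + 1) * √T := by
        gcongr
        linarith
end
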